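/- arXiv:2110.15035 — 4 statements merged into one kernel-verified Lean document; each statement's English description precedes it below -/
import Mathlib

section
/- Let ε ≥ 1 and q ≥ ε be integers, let k = q mod ε, let ρ_i = (k·i) mod ε for 0 ≤ i ≤ ε−1 and ρ_ε = ε. For 1 ≤ i ≤ ε−1 let J_i = { j ∈ ℤ : ⌊(i−1)q/ε⌋ < j ≤ ⌊iq/ε⌋ }, and let J_ε = { j ∈ ℤ : ⌊(ε−1)q/ε⌋ < j ≤ q−1 }. Then for every 1 ≤ i ≤ ε one has |J_i| = (q − ρ_i + ρ_{i−1})/ε, and ∑_{j ∈ J_1 ∪ ⋯ ∪ J_i} (ε·j − 1) = (iq − ρ_i)(iq − ρ_i + ε − 2)/(2ε). -/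
open Finset

theorem aux_sum (e : ℚ) (n : ℕ) : ∑ j ∈ Finset.Ioc 0 n, (e * (j : ℚ) - 1) =
    (n : ℚ) * (e * n + e - 2) / 2 := by
  induction n with
  | zero => simp
  | succ n ih =>
    rw [Finset.sum_Ioc_succ_top (Nat.zero_le n), ih]
    push_cast
    ring

theorem hirzebruch_partition_card_and_sum (ε q : ℕ) (hε : 1 ≤ ε) (hq : ε ≤ q)
    (k : ℕ) (hk : k = q % ε)
    (ρ : ℕ → ℕ) (hρ : ∀ i, i ≤ ε - 1 → ρ i = k * i % ε) (hρε : ρ ε = ε)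
    (J : ℕ → Finset ℕ)
    (hJ : ∀ i, 1 ≤ i → i ≤ ε - 1 → J i = Finset.Ioc ((i - 1) * q / ε) (i * q / ε))
    (hJε : J ε = Finset.Ioc ((ε - 1) * q / ε) (q - 1)) :
    ∀ i, 1 ≤ i → i ≤ ε →
      ((J i).card : ℚ) = ((q : ℚ) - (ρ i : ℚ) + (ρ (i - 1) : ℚ)) / (ε : ℚ) ∧
      (∑ j ∈ (Finset.Icc 1 i).biUnion J, ((ε : ℚ) * (j : ℚ) - 1)) =
        ((i : ℚ) * q - (ρ i : ℚ)) * ((i : ℚ) * q - (ρ i : ℚ) + (ε : ℚ) - 2) / (2 * ε) := by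
  obtain ⟨N, hN⟩ : ∃ N : ℕ → ℕ, N = fun i => if i = ε then q - 1 else i * q / ε := ⟨_, rfl⟩
  have hNlt : ∀ i, i < ε → N i = i * q / ε := by
    intro i hi
    simp [hN, hi.ne]
  have hNe : N ε = q - 1 := by simp [hN]
  have hN0 : N 0 = 0 := by rw [hNlt 0 hε]; simp
  have hNρ : ∀ i, i ≤ ε → ε * N i + ρ i = i * q := by
    intro i hi
    rcases hi.lt_or_eq with h | h
    · rw [hNlt i h, hρ i (by omega), hk]
      have : q % ε * i % ε = i * q % ε := by
        rw [Nat.mod_mul_mod, mul_comm]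
      rw [this, Nat.div_add_mod]
    · subst h
      rw [hNe, hρε]
      obtain ⟨r, rfl⟩ : ∃ r, q = r + 1 := ⟨q - 1, by omega⟩
      simp [mul_add]
  have hmono : ∀ i, i + 1 ≤ ε → N i ≤ N (i + 1) := by
    intro i hi
    rcases hi.lt_or_eq with h | h
    · rw [hNlt i (by omega), hNlt _ h]
      exact Nat.div_le_div_right (Nat.mul_le_mul_right _ (by omega))
    · have h1 := hNρ i (by omega)
      have h2 := hNρ (i + 1) hi
      rw [h, hρε, ← h] at h2
      rw [← h] at h1 hq
      have : (i + 1) * N i ≤ (i + 1) * N (i + 1) := by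
        rw [h] at h2 ⊢
        rw [← h] at h2 ⊢
        nlinarith
      exact Nat.le_of_mul_le_mul_left this (by omega)
  have hJN : ∀ i, i + 1 ≤ ε → J (i + 1) = Finset.Ioc (N i) (N (i + 1)) := by
    intro i hi
    rcases hi.lt_or_eq with h | h
    · rw [hNlt i (by omega), hNlt _ h, hJ _ (by omega) (by omega)]
      simp
    · rw [h, hJε, hNe, hNlt i (by omega)]
      have : ε - 1 = i := by omega
      rw [this]
  have hU : ∀ i, i ≤ ε → (Finset.Icc 1 i).biUnion J = Finset.Ioc 0 (N i) := by
    intro i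
    induction i with
    | zero => intro _; simp [hN0]
    | succ i ih =>
      intro hi
      have hI : Finset.Icc 1 (i + 1) = insert (i + 1) (Finset.Icc 1 i) := by
        ext x; simp only [Finset.mem_Icc, Finset.mem_insert]; omega
      rw [hI, Finset.biUnion_insert, ih (by omega), hJN i hi]
      have := hmono i hi
      ext x; simp only [Finset.mem_union, Finset.mem_Ioc]; omega
  have hε0 : (ε : ℚ) ≠ 0 := by
    have : ε ≠ 0 := by omega
    exact_mod_cast this
  have hQ : ∀ i, i ≤ ε → (ε : ℚ) * N i + ρ i = i * q := by
    intro i hi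
    exact_mod_cast hNρ i hi
  intro i hi1 hi
  obtain ⟨i, rfl⟩ : ∃ r, i = r + 1 := ⟨i - 1, by omega⟩
  have hb := hQ (i + 1) hi
  constructor
  · have ha := hQ i (by omega)
    rw [hJN i hi, Nat.card_Ioc, Nat.cast_sub (hmono i hi), eq_div_iff hε0, Nat.add_sub_cancel]
    push_cast at hb
    linarith
  · rw [hU _ hi, aux_sum, ← hb]
    field_simp
    ring
end

section
/- Let ε ≥ 2 and q ≥ ε be integers, let k = q mod ε, let ρ_i = (k·i) mod ε for 0 ≤ i ≤ ε−1 and ρ_ε = ε, and let J_1,…,J_ε be the partition of {1,…,q−1} with J_i = { j : ⌊(i−1)q/ε⌋ < j ≤ ⌊iq/ε⌋ } for i < ε and J_ε = { j : ⌊(ε−1)q/ε⌋ < j ≤ q−1 }. Define σ_1 = 1·q·|J_1| − ∑_{j∈J_1}(εj−1) and σ_{ε+1} = −(ε−1)·q·|J_ε| + ∑_{j∈J_ε}(εj−1). Then σ_1 = (q − ρ_1)(q + ρ_1 − ε + 2)/(2ε) and σ_{ε+1} = (q − ε + ρ_{ε−1})(q − ρ_{ε−1} − 2)/(2ε). -/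
open Finset

theorem sum_aux (e : ℚ) (a n : ℕ) :
    ∑ j ∈ Finset.Ioc a (a + n), (e * (j : ℚ) - 1) = n * (e * (2 * a + n + 1) / 2 - 1) := by
  induction n with
  | zero => simp
  | succ n ih =>
    rw [← add_assoc, Finset.sum_Ioc_succ_top (by omega), ih]
    push_cast
    ring

theorem hirzebruch_sigma_extremes (ε q : ℕ) (hε : 2 ≤ ε) (hq : ε ≤ q)
    (k : ℕ) (hk : k = q % ε)
    (ρ : ℕ → ℕ) (hρ : ∀ i, i ≤ ε - 1 → ρ i = k * i % ε) (hρε : ρ ε = ε)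
    (J : ℕ → Finset ℕ)
    (hJ : ∀ i, 1 ≤ i → i ≤ ε - 1 → J i = Finset.Ioc ((i - 1) * q / ε) (i * q / ε))
    (hJε : J ε = Finset.Ioc ((ε - 1) * q / ε) (q - 1))
    (σ₁ σ : ℚ)
    (hσ₁ : σ₁ = 1 * (q : ℚ) * ((J 1).card : ℚ) - ∑ j ∈ J 1, ((ε : ℚ) * (j : ℚ) - 1))
    (hσ : σ = -(((ε : ℚ) - 1) * (q : ℚ) * ((J ε).card : ℚ)) +
      ∑ j ∈ J ε, ((ε : ℚ) * (j : ℚ) - 1)) :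
    σ₁ = ((q : ℚ) - (ρ 1 : ℚ)) * ((q : ℚ) + (ρ 1 : ℚ) - (ε : ℚ) + 2) / (2 * ε) ∧
      σ = ((q : ℚ) - (ε : ℚ) + (ρ (ε - 1) : ℚ)) * ((q : ℚ) - (ρ (ε - 1) : ℚ) - 2) / (2 * ε) := by
  have hpos : (ε : ℚ) ≠ 0 := by
    have : ε ≠ 0 := by omega
    exact_mod_cast this
  constructor
  · have h1 := hρ 1 (by omega)
    have h2 := hJ 1 le_rfl (by omega)
    simp only [mul_one, hk, Nat.mod_mod] at h1
    simp only [Nat.sub_self, zero_mul, Nat.zero_div, one_mul] at h2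
    have h3 : (ε : ℚ) * ((q / ε : ℕ) : ℚ) + (ρ 1 : ℚ) = q := by
      rw [h1]; exact_mod_cast Nat.div_add_mod q ε
    have h4 := sum_aux (ε : ℚ) 0 (q / ε)
    rw [zero_add] at h4
    rw [hσ₁, h2, h4, Nat.card_Ioc, Nat.sub_zero]
    generalize ((q / ε : ℕ) : ℚ) = a at *
    rw [← h3]
    field_simp
    push_cast
    ring
  · have h1 := hρ (ε - 1) le_rfl
    have h1' : ρ (ε - 1) = (ε - 1) * q % ε := by
      rw [h1, hk, mul_comm, Nat.mul_mod_mod]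
    have h3 : (ε : ℚ) * (((ε - 1) * q / ε : ℕ) : ℚ) + (ρ (ε - 1) : ℚ) = ((ε : ℚ) - 1) * q := by
      rw [h1']
      have := Nat.div_add_mod ((ε - 1) * q) ε
      have h5 : ((ε - 1 : ℕ) : ℚ) = (ε : ℚ) - 1 := by
        rw [Nat.cast_sub (by omega)]; simp
      rw [← h5]
      exact_mod_cast this
    have hlt : (ε - 1) * q / ε < q := by
      rw [Nat.div_lt_iff_lt_mul (by omega), mul_comm q]
      exact Nat.mul_lt_mul_of_pos_right (by omega) (by omega)
    generalize (ε - 1) * q / ε = b at *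
    obtain ⟨n, rfl⟩ : ∃ n, q = b + n + 1 := ⟨q - 1 - b, by omega⟩
    have h6 : b + n + 1 - 1 = b + n := by omega
    rw [hσ, hJε, h6, sum_aux, Nat.card_Ioc, Nat.add_sub_cancel_left]
    have h7 : (ρ (ε - 1) : ℚ) = ((ε : ℚ) - 1) * ((b + n + 1 : ℕ) : ℚ) - ε * b := by linarith
    rw [h7]
    push_cast
    field_simp
    ring
end

section
/- Let ε ≥ 2 and q ≥ ε be integers, let k = q mod ε, let ρ_i = (k·i) mod ε for 0 ≤ i ≤ ε−1 and ρ_ε = ε, and let J_1,…,J_ε be the partition of {1,…,q−1} with J_i = { j : ⌊(i−1)q/ε⌋ < j ≤ ⌊iq/ε⌋ } for i < ε and J_ε = { j : ⌊(ε−1)q/ε⌋ < j ≤ q−1 }. For 1 ≤ i ≤ ε set σ_i' = i·q·|J_i| − ∑_{j∈J_i}(εj−1) and σ_i'' = −(i−1)·q·|J_i| + ∑_{j∈J_i}(εj−1), and for 2 ≤ i ≤ ε set σ_i = σ_i' + σ_{i−1}''. Then for every 2 ≤ i ≤ ε: σ_i = ( q² − (ρ_i² − 2ρ_{i−1}² +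 ρ_{i−2}² − (ε−2)(ρ_i − 2ρ_{i−1} + ρ_{i−2}))/2 ) / ε. -/
open Finset

theorem sum_Ioc_aux (e : ℚ) (a b : ℕ) (h : a ≤ b) :
    ∑ j ∈ Finset.Ioc a b, (e * (j : ℚ) - 1) =
      e * ((b : ℚ) * (b + 1) - (a : ℚ) * (a + 1)) / 2 - ((b : ℚ) - a) := by
  induction b, h using Nat.le_induction with
  | base => simp
  | succ n hn ih =>
    rw [← Finset.insert_Ioc_right_eq_Ioc_add_one hn, Finset.sum_insert (by simp), ih]
    push_cast
    ring

theorem hirzebruch_sigma_middle (ε q : ℕ) (hε : 2 ≤ ε) (hq : ε ≤ q)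
    (k : ℕ) (hk : k = q % ε)
    (ρ : ℕ → ℕ) (hρ : ∀ i, i ≤ ε - 1 → ρ i = k * i % ε) (hρε : ρ ε = ε)
    (J : ℕ → Finset ℕ)
    (hJ : ∀ i, 1 ≤ i → i ≤ ε - 1 → J i = Finset.Ioc ((i - 1) * q / ε) (i * q / ε))
    (hJε : J ε = Finset.Ioc ((ε - 1) * q / ε) (q - 1))
    (σ' σ'' : ℕ → ℚ)
    (hσ' : ∀ i, 1 ≤ i → i ≤ ε →
      σ' i = (i : ℚ) * (q : ℚ) * ((J i).card : ℚ) - ∑ j ∈ J i, ((ε : ℚ) * (j : ℚ) - 1))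
    (hσ'' : ∀ i, 1 ≤ i → i ≤ ε →
      σ'' i = -(((i : ℚ) - 1) * (q : ℚ) * ((J i).card : ℚ)) +
        ∑ j ∈ J i, ((ε : ℚ) * (j : ℚ) - 1))
    (σ : ℕ → ℚ) (hσ : ∀ i, 2 ≤ i → i ≤ ε → σ i = σ' i + σ'' (i - 1)) :
    ∀ i, 2 ≤ i → i ≤ ε →
      σ i = ((q : ℚ) ^ 2 -
          ((ρ i : ℚ) ^ 2 - 2 * (ρ (i - 1) : ℚ) ^ 2 + (ρ (i - 2) : ℚ) ^ 2 -
            ((ε : ℚ) - 2) * ((ρ i : ℚ) - 2 * (ρ (i - 1) : ℚ) + (ρ (i - 2) : ℚ))) / 2) /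
        (ε : ℚ) := by
  have hε0 : 0 < ε := by omega
  obtain ⟨m, hm⟩ : ∃ m : ℕ → ℕ, ∀ i, m i = if i = ε then q - 1 else i * q / ε :=
    ⟨_, fun _ => rfl⟩
  have hlt : ∀ i, i < ε → m i = i * q / ε := fun i hi => by rw [hm, if_neg (by omega)]
  have hmε : m ε = q - 1 := by rw [hm, if_pos rfl]
  have hmρ : ∀ i, i ≤ ε → (ε : ℚ) * (m i : ℚ) + (ρ i : ℚ) = (i : ℚ) * (q : ℚ) := by
    intro i hi
    rcases Nat.lt_or_ge i ε with h | h
    · have h1 : ρ i = i * q % ε := by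
        rw [hρ i (by omega), hk, Nat.mod_mul_mod, mul_comm]
      rw [h1, hlt i h]
      exact_mod_cast Nat.div_add_mod (i * q) ε
    · have h2 : i = ε := by omega
      subst h2
      rw [hρε, hmε, Nat.cast_sub (by omega)]
      push_cast
      ring
  have hmono : ∀ i, 1 ≤ i → i ≤ ε → m (i - 1) ≤ m i := by
    intro i h1 hi
    rw [hlt (i - 1) (by omega)]
    rcases Nat.lt_or_ge i ε with h | h
    · rw [hlt i h]
      exact Nat.div_le_div_right (Nat.mul_le_mul_right _ (by omega))
    · have h2 : i = ε := by omega
      subst h2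
      rw [hmε]
      have : (i - 1) * q / i < q := by
        rw [Nat.div_lt_iff_lt_mul hε0, mul_comm q]
        exact Nat.mul_lt_mul_of_pos_right (by omega) (by omega)
      omega
  have hJm : ∀ i, 1 ≤ i → i ≤ ε → J i = Finset.Ioc (m (i - 1)) (m i) := by
    intro i h1 hi
    rw [hlt (i - 1) (by omega)]
    rcases Nat.lt_or_ge i ε with h | h
    · rw [hlt i h, hJ i h1 (by omega)]
    · have h2 : i = ε := by omega
      subst h2
      rw [hmε, hJε]
  intro i h2 hi
  obtain ⟨n, rfl⟩ : ∃ n, i = n + 2 := ⟨i - 2, by omega⟩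
  have e1 : n + 2 - 1 = n + 1 := rfl
  have e2 : n + 2 - 2 = n := rfl
  have e3 : n + 1 - 1 = n := rfl
  have ma := hmono (n + 2) (by omega) hi
  have mb := hmono (n + 1) (by omega) (by omega)
  have ja := hJm (n + 2) (by omega) hi
  have jb := hJm (n + 1) (by omega) (by omega)
  have ra := hmρ (n + 2) hi
  have rb := hmρ (n + 1) (by omega)
  have rc := hmρ n (by omega)
  rw [hσ _ h2 hi, hσ' _ (by omega) hi, e1, e2, hσ'' _ (by omega) (by omega)]
  rw [e1] at ma ja
  rw [e3] at mb jb
  rw [ja, jb, sum_Ioc_aux _ _ _ ma, sum_Ioc_aux _ _ _ mb, Nat.card_Ioc, Nat.card_Ioc,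
    Nat.cast_sub ma, Nat.cast_sub mb]
  have hεq : (ε : ℚ) ≠ 0 := by positivity
  have ra' := eq_sub_of_add_eq' ra
  have rb' := eq_sub_of_add_eq' rb
  have rc' := eq_sub_of_add_eq' rc
  rw [eq_sub_of_add_eq' ra, eq_sub_of_add_eq' rb, eq_sub_of_add_eq' rc]
  push_cast
  field_simp
  ring
end

section
/- Let k be a field and let S = ⊕_{i≥0} S_i be a commutative ℕ-graded ring with S_0 = k that is generated as a k-algebra by finitely many elements of S_1. Let 𝔪 = S_+ = ⊕_{i≥1} S_i be the irrelevant maximal ideal. If the localization S_𝔪 is a regular local ring, then S is isomorphic as a graded k-algebra to the polynomial ring k[x_1,…,x_d] with its standard grading (each x_i of degree 1), where d = dim S_𝔪; that is, there is a k-algebra isomorphism S ≅ k[x_1,…,x_d] carrying S_n onto the space of homogeneous polynomials of degree n for every n. -/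
/-- A Noetherian local ring is regular if its maximal ideal can be generated by
`dim R` many elements (cf. the context: "Regularity of the Noetherian local ring `S_𝔪`
means that its maximal ideal is generated by `dim S_𝔪` elements"). -/
def IsRegularLocal (R : Type*) [CommRing R] [IsLocalRing R] : Prop :=
  IsNoetherianRing R ∧
    ∃ s : Finset R, Ideal.span (s : Set R) = IsLocalRing.maximalIdeal R ∧
      ringKrullDim R = (s.card : WithBot ℕ∞)

open DirectSum in
theorem aux_deg_one {k S : Type*} [Field k] [CommRing S]
    [Algebra k S] (𝒜 : ℕ → Submodule k S) [GradedAlgebra 𝒜] (a b : S) :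
    (decompose 𝒜 (a * b) 1 : S) =
      decompose 𝒜 a 0 * decompose 𝒜 b 1 + decompose 𝒜 a 1 * decompose 𝒜 b 0 := by
  induction a using DirectSum.Decomposition.inductionOn 𝒜 with
  | zero => simp
  | @homogeneous i m =>
    rw [coe_decompose_mul_of_left_mem 𝒜 1 m.2]
    rcases i with _ | _ | i
    · simp [decompose_coe, of_eq_of_ne]
    · simp [decompose_coe, of_eq_of_ne]
    · simp [decompose_coe, of_eq_of_ne]
  | add x y hx hy =>
    simp only [add_mul, decompose_add, DirectSum.add_apply, Submodule.coe_add, hx, hy]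
    ring

theorem aux_aeval_mem {k S : Type*} [Field k] [CommRing S]
    [Algebra k S] (𝒜 : ℕ → Submodule k S) [GradedAlgebra 𝒜] {d : ℕ} (y : Fin d → S)
    (hy : ∀ i, y i ∈ 𝒜 1) (n : ℕ) (p : MvPolynomial (Fin d) k) (hp : p.IsHomogeneous n) :
    MvPolynomial.aeval y p ∈ 𝒜 n := by
  rw [MvPolynomial.aeval_def, MvPolynomial.eval₂_eq]
  refine Submodule.sum_mem _ fun e he => ?_
  rw [← Algebra.smul_def]
  refine Submodule.smul_mem _ _ ?_
  have h1 : e.degree = n := by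
    have := hp (MvPolynomial.mem_support_iff.mp he)
    rwa [Finsupp.degree_eq_weight_one]
  have := SetLike.prod_pow_mem_graded 𝒜 (F := e.support) (fun _ => 1) y e (fun i _ => hy i)
  have h2 : ∑ i ∈ e.support, e i • 1 = n := by
    rw [← h1]; simp [Finsupp.degree_apply]
  rwa [h2] at this

open DirectSum in
theorem standard_graded_regular_iso_polynomial {k S : Type*} [Field k] [CommRing S]
    [Algebra k S] (𝒜 : ℕ → Submodule k S) [GradedAlgebra 𝒜]
    (h0 : 𝒜 0 = (1 : Submodule k S))
    (hgen : ∃ s : Finset S, (s : Set S) ⊆ (𝒜 1 : Set S) ∧ Algebra.adjoin k (s : Set S) = ⊤)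
    (m : Ideal S) (hm : m = (HomogeneousIdeal.irrelevant 𝒜).toIdeal) [m.IsMaximal]
    (hreg : IsRegularLocal (Localization.AtPrime m)) :
    ∃ d : ℕ, ringKrullDim (Localization.AtPrime m) = (d : WithBot ℕ∞) ∧
      ∃ f : S ≃ₐ[k] MvPolynomial (Fin d) k,
        ∀ n : ℕ, Submodule.map f.toLinearMap (𝒜 n) =
          MvPolynomial.homogeneousSubmodule (Fin d) k n := by
  obtain ⟨-, s, hs, hdim⟩ := hreg
  obtain ⟨g, hg1, hgtop⟩ := hgen
  refine ⟨s.card, hdim, ?_⟩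
  have hmem : ∀ x, x ∈ m ↔ (decompose 𝒜 x 0 : S) = 0 := by
    intro x
    rw [hm]
    exact HomogeneousIdeal.mem_irrelevant_iff 𝒜 x
  -- clear denominators
  have hsurj : ∀ t : Localization.AtPrime m, ∃ a : S, ∃ u : m.primeCompl,
      t * algebraMap S _ (u : S) = algebraMap S _ a := by
    intro t
    obtain ⟨⟨a, u⟩, h⟩ := IsLocalization.surj m.primeCompl t
    exact ⟨a, u, h⟩
  choose a u hau using hsurj
  let e := s.equivFin.symm
  let b : Fin s.card → S := fun i => a (e i)
  have hbm : ∀ i, b i ∈ m := by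
    intro i
    rw [← IsLocalization.AtPrime.to_map_mem_maximal_iff (Localization.AtPrime m) m]
    rw [← hau, ← hs]
    exact Ideal.mul_mem_right _ _ (Ideal.subset_span (e i).2)
  let y : Fin s.card → S := fun i => (decompose 𝒜 (b i) 1 : S)
  have hy : ∀ i, y i ∈ 𝒜 1 := fun i => (decompose 𝒜 (b i) 1).2
  have hle : IsLocalRing.maximalIdeal (Localization.AtPrime m) ≤
      (Ideal.span (Set.range b)).map (algebraMap S (Localization.AtPrime m)) := by
    rw [← hs, Ideal.span_le]
    intro t ht
    have hu : IsUnit (algebraMap S (Localization.AtPrime m) (u t : S)) :=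
      IsLocalization.map_units _ (u t)
    rw [SetLike.mem_coe, ← Ideal.mul_unit_mem_iff_mem _ hu, hau]
    refine Ideal.mem_map_of_mem _ (Ideal.subset_span ⟨e.symm ⟨t, ht⟩, ?_⟩)
    simp [b]
  have h0' : ∀ c ∈ 𝒜 0, ∃ r : k, algebraMap k S r = c := by
    intro c hc
    rw [h0] at hc
    simpa using Submodule.mem_one.mp hc
  have hspan : ∀ x ∈ 𝒜 1, x ∈ Submodule.span k (Set.range y) := by
    intro x hx
    have hxm : x ∈ m := by
      rw [hmem, decompose_of_mem_ne 𝒜 hx (by simp)]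
    have := hle ((IsLocalization.AtPrime.to_map_mem_maximal_iff
      (Localization.AtPrime m) m x).mpr hxm)
    rw [IsLocalization.algebraMap_mem_map_algebraMap_iff m.primeCompl] at this
    obtain ⟨v, hv, hvx⟩ := this
    obtain ⟨c, hc⟩ := (Submodule.mem_span_range_iff_exists_fun S).mp hvx
    have h1 := congrArg (fun z => (decompose 𝒜 z 1 : S)) hc
    simp only [smul_eq_mul] at h1
    rw [aux_deg_one, (hmem x).mp hxm, decompose_of_mem_same 𝒜 hx, mul_zero, add_zero,
      decompose_sum, DFinsupp.finsetSum_apply, AddSubmonoidClass.coe_finsetSum] at h1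
    have hv0 : (decompose 𝒜 v 0 : S) ≠ 0 := fun h => hv ((hmem v).mpr h)
    obtain ⟨r, hr⟩ := h0' _ (decompose 𝒜 v 0).2
    have hr0 : r ≠ 0 := by
      rintro rfl
      exact hv0 (by rw [← hr, map_zero])
    rw [← hr, ← Algebra.smul_def] at h1
    rw [← Submodule.smul_mem_iff _ hr0, ← h1]
    refine Submodule.sum_mem _ fun i _ => ?_
    rw [aux_deg_one, (hmem _).mp (hbm i), mul_zero, add_zero]
    obtain ⟨q, hq⟩ := h0' _ (decompose 𝒜 (c i) 0).2
    rw [← hq, ← Algebra.smul_def]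
    exact Submodule.smul_mem _ _ (Submodule.subset_span ⟨i, rfl⟩)
  let φ : MvPolynomial (Fin s.card) k →ₐ[k] S := MvPolynomial.aeval y
  have hφs : Function.Surjective φ := by
    rw [← AlgHom.range_eq_top, eq_top_iff, ← hgtop]
    refine Algebra.adjoin_le fun x hx => ?_
    have h1 := hspan x (hg1 hx)
    have h2 : Submodule.span k (Set.range y) ≤ Subalgebra.toSubmodule φ.range := by
      rw [Submodule.span_le]
      rintro _ ⟨i, rfl⟩
      exact ⟨MvPolynomial.X i, by simp [φ]⟩
    exact h2 h1
  have hφi : Function.Injective φ := by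
    rw [injective_iff_map_eq_zero]
    intro p hp
    by_contra hp0
    have h1 := ringKrullDim_succ_le_of_surjective φ.toRingHom hφs
      (mem_nonZeroDivisors_of_ne_zero hp0) hp
    rw [MvPolynomial.ringKrullDim_of_isNoetherianRing, ringKrullDim_eq_zero_of_field,
      Nat.card_fin, zero_add] at h1
    have h2 : ringKrullDim (Localization.AtPrime m) ≤ ringKrullDim S := by
      rw [IsLocalization.AtPrime.ringKrullDim_eq_height m]
      exact Ideal.height_le_ringKrullDim_of_ne_top Ideal.IsPrime.ne_top'
    rw [hdim] at h2
    have h3 : ((s.card : WithBot ℕ∞)) + 1 ≤ s.card := le_trans (by gcongr) h1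
    have h4 : s.card + 1 ≤ s.card := by exact_mod_cast h3
    omega
  have hφd : ∀ p n, (decompose 𝒜 (φ p) n : S) =
      φ (MvPolynomial.homogeneousComponent n p) := by
    intro p n
    have hmm : ∀ j, φ (MvPolynomial.homogeneousComponent j p) ∈ 𝒜 j := fun j =>
      aux_aeval_mem 𝒜 y hy j _ (MvPolynomial.homogeneousComponent_isHomogeneous j p)
    conv_lhs => rw [← MvPolynomial.sum_homogeneousComponent p, map_sum]
    rw [decompose_sum, DFinsupp.finsetSum_apply, AddSubmonoidClass.coe_finsetSum,
      Finset.sum_eq_single n]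
    · exact decompose_of_mem_same 𝒜 (hmm n)
    · intro j _ hj
      exact decompose_of_mem_ne 𝒜 (hmm j) hj
    · intro hn
      rw [MvPolynomial.homogeneousComponent_eq_zero n p (by simpa using hn)]
      simp
  let F := AlgEquiv.ofBijective φ ⟨hφi, hφs⟩
  have hF : ∀ p, F p = φ p := fun p => rfl
  refine ⟨F.symm, fun n => ?_⟩
  ext p
  constructor
  · rintro ⟨x, hx, rfl⟩
    obtain ⟨p, rfl⟩ := hφs x
    have h1 := hφd p n
    rw [decompose_of_mem_same 𝒜 hx] at h1
    have h2 : F.symm.toLinearMap (φ p) = p := by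
      change F.symm (φ p) = p
      rw [← hF]; simp
    rw [h2, hφi h1]
    exact MvPolynomial.homogeneousComponent_mem n p
  · intro hp
    refine ⟨φ p, aux_aeval_mem 𝒜 y hy n p hp, ?_⟩
    change F.symm (φ p) = p
    rw [← hF]; simp
end
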